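/- arXiv:2106.12087 — 4 statements merged into one kernel-verified Lean document; each statement's English description precedes it below -/
import Mathlib

section
/- The point spectrum of the Perron–Frobenius operator V_S on L²(Σ₊, μ₊) equals {z ∈ ℂ : |z| < 1} ∪ {1}. The eigenspace of the eigenvalue 1 is one-dimensional, consisting of the constant functions. For each λ with |λ| < 1 the eigenspace is infinite-dimensional: for every odd positive integer n the function Σ_{r≥0} λ^r W_{2^r n} belongs to L²(Σ₊, μ₊) and is an eigenfunction of V_S with eigenvalue λ, and these eigenfunctions over distinct odd n are linearly independent. -/
open MeasureTheory Filter
open scoped ENNReal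

noncomputable section

/-- The one-sided full 2-shift space `Σ₊ = {0,1}^ℕ` (index `n` corresponds to `ω_{n+1}`). -/
abbrev OneSided : Type := ℕ → Fin 2

/-- The left shift `(Sω)_j = ω_{j+1}`. -/
def shift (ω : OneSided) : OneSided := fun n => ω (n + 1)

/-- `μ` is the uniform Bernoulli product measure. -/
def IsUnifBernoulli (μ : Measure OneSided) : Prop :=
  ∀ (n : ℕ) (x : Fin n → Fin 2), μ {ω | ∀ i : Fin n, ω i = x i} = (2 : ℝ≥0∞)⁻¹ ^ n

/-- The `n`-th Walsh function. -/
def walsh (n : ℕ) (ω : OneSided) : ℂ :=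
  ∏ k ∈ Finset.range n, if n.testBit k then (-1 : ℂ) ^ (ω k : ℕ) else 1

theorem walsh_eq_prod_range {n N : ℕ} (h : n ≤ N) (ω : OneSided) :
    walsh n ω = ∏ k ∈ Finset.range N, if n.testBit k then (-1 : ℂ) ^ (ω k : ℕ) else 1 := by
  refine Finset.prod_subset (Finset.range_mono h) fun k _ hk => ?_
  have hk : n ≤ k := by simpa using hk
  simp [Nat.testBit_lt_two_pow (hk.trans_lt k.lt_two_pow_self)]

theorem walsh_zero (ω : OneSided) : walsh 0 ω = 1 := by simp [walsh]

theorem walsh_two_mul (n : ℕ) (ω : OneSided) : walsh (2 * n) ω = walsh n (shift ω) := by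
  rw [walsh_eq_prod_range (Nat.le_succ _), walsh_eq_prod_range (show n ≤ 2 * n by lia),
    Finset.prod_range_succ']
  simp [Nat.testBit_succ, shift]

theorem walsh_mul_walsh (m n : ℕ) (ω : OneSided) :
    walsh m ω * walsh n ω = walsh (m ^^^ n) ω := by
  rw [walsh_eq_prod_range (le_max_left m (max n (m ^^^ n))),
    walsh_eq_prod_range (show n ≤ max m (max n (m ^^^ n)) by simp),
    walsh_eq_prod_range (show m ^^^ n ≤ max m (max n (m ^^^ n)) by simp),
    ← Finset.prod_mul_distrib]
  refine Finset.prod_congr rfl fun k _ => ?_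
  rw [Nat.testBit_xor]
  cases m.testBit k <;> cases n.testBit k <;> simp [← mul_pow]

theorem walsh_two_pow (k : ℕ) (ω : OneSided) : walsh (2 ^ k) ω = (-1) ^ (ω k : ℕ) := by
  rw [walsh, Finset.prod_eq_single k]
  · simp
  · intro j _ hj
    simp [Nat.testBit_two_pow_of_ne hj.symm]
  · intro hk
    exact absurd (Finset.mem_range.2 k.lt_two_pow_self) hk

theorem conj_walsh (n : ℕ) (ω : OneSided) : (starRingEnd ℂ) (walsh n ω) = walsh n ω := by
  rw [walsh, map_prod]
  refine Finset.prod_congr rfl fun k _ => ?_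
  split_ifs <;> simp

theorem norm_walsh (n : ℕ) (ω : OneSided) : ‖walsh n ω‖ = 1 := by
  rw [walsh, norm_prod]
  refine Finset.prod_eq_one fun k _ => ?_
  split_ifs <;> simp

theorem continuous_walsh (n : ℕ) : Continuous (walsh n) := by
  refine continuous_finsetProd _ fun k _ => ?_
  split_ifs
  · exact (continuous_of_discreteTopology (f := fun x : Fin 2 => (-1 : ℂ) ^ (x : ℕ))).comp
      (continuous_apply k)
  · exact continuous_const

theorem integral_walsh_of_ne_zero {μ : Measure OneSided} [IsProbabilityMeasure μ]
    (hμ : IsUnifBernoulli μ) {n : ℕ} (hn : n ≠ 0) : ∫ ω, walsh n ω ∂μ = 0 := by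
  obtain ⟨k, hk⟩ := Nat.exists_testBit_of_ne_zero hn
  have hkn : k < n := by
    by_contra! h
    rw [Nat.testBit_lt_two_pow (h.trans_lt k.lt_two_pow_self)] at hk
    exact Bool.false_ne_true hk
  let φ : OneSided → Fin n → Fin 2 := fun ω i => ω i
  let g : Fin n → Fin 2 → ℂ := fun i b => if n.testBit i then (-1 : ℂ) ^ (b : ℕ) else 1
  have hφ : Measurable φ := by fun_prop
  have hw : ∀ ω, walsh n ω = (fun x : Fin n → Fin 2 => ∏ i, g i (x i)) (φ ω) := fun ω =>
    Finset.prod_range fun k => if n.testBit k then (-1 : ℂ) ^ (ω k : ℕ) else 1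
  have := Measure.isProbabilityMeasure_map (μ := μ) hφ.aemeasurable
  have hmap : ∀ x, (μ.map φ).real {x} = (2 : ℝ)⁻¹ ^ n := fun x => by
    have hx : φ ⁻¹' {x} = {ω | ∀ i : Fin n, ω i = x i} := by
      ext ω
      simp [φ, funext_iff]
    rw [measureReal_def, Measure.map_apply hφ (measurableSet_singleton x), hx, hμ n x]
    simp
  rw [integral_congr_ae (ae_of_all _ hw),
    ← integral_map_of_stronglyMeasurable (f := fun x : Fin n → Fin 2 => ∏ i, g i (x i)) hφ
      .of_discrete,
    integral_fintype Integrable.of_finite]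
  simp_rw [hmap]
  rw [← Finset.smul_sum, ← Fintype.prod_sum,
    Finset.prod_eq_zero (Finset.mem_univ (⟨k, hkn⟩ : Fin n)) (by simp [g, hk]), smul_zero]

/-- The Walsh functions as continuous maps. -/
def walshContinuousMap (n : ℕ) : C(OneSided, ℂ) := ⟨walsh n, continuous_walsh n⟩

/-- The star subalgebra of `C(OneSided, ℂ)` generated by the Walsh functions. -/
def walshSubalgebra : StarSubalgebra ℂ C(OneSided, ℂ) where
  toSubalgebra := Algebra.adjoin ℂ (Set.range walshContinuousMap)
  star_mem' := by
    change Algebra.adjoin ℂ (Set.range walshContinuousMap) ≤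
      star (Algebra.adjoin ℂ (Set.range walshContinuousMap))
    refine Algebra.adjoin_le ?_
    rintro - ⟨n, rfl⟩
    refine Algebra.subset_adjoin ⟨n, ?_⟩
    ext ω
    exact (conj_walsh n ω).symm

theorem toSubmodule_walshSubalgebra :
    Subalgebra.toSubmodule walshSubalgebra.toSubalgebra =
      Submodule.span ℂ (Set.range walshContinuousMap) := by
  refine Algebra.adjoin_eq_span_of_subset _ (Set.Subset.trans ?_ Submodule.subset_span)
  intro x hx
  refine Submonoid.closure_induction (fun _ => id) ⟨0, ?_⟩ ?_ hx
  · ext ω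
    exact walsh_zero ω
  · rintro - - - - ⟨m, rfl⟩ ⟨n, rfl⟩
    refine ⟨m ^^^ n, ?_⟩
    ext ω
    exact (walsh_mul_walsh m n ω).symm

theorem separatesPoints_walshSubalgebra : walshSubalgebra.SeparatesPoints := by
  intro x y hxy
  obtain ⟨k, hk⟩ := Function.ne_iff.1 hxy
  refine ⟨_, ⟨walshContinuousMap (2 ^ k), Algebra.subset_adjoin ⟨2 ^ k, rfl⟩, rfl⟩, ?_⟩
  change walsh (2 ^ k) x ≠ walsh (2 ^ k) y
  rw [walsh_two_pow, walsh_two_pow]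
  generalize x k = a at *
  generalize y k = b at *
  fin_cases a <;> fin_cases b <;> first | exact absurd rfl hk | norm_num

theorem topologicalClosure_span_walshContinuousMap :
    (Submodule.span ℂ (Set.range walshContinuousMap)).topologicalClosure = ⊤ := by
  rw [← toSubmodule_walshSubalgebra]
  exact congr_arg (Subalgebra.toSubmodule <| StarSubalgebra.toSubalgebra ·)
    (ContinuousMap.starSubalgebra_topologicalClosure_eq_top_of_separatesPoints walshSubalgebra
      separatesPoints_walshSubalgebra)

section WalshLp

variable (μ : Measure OneSided) [IsProbabilityMeasure μ]

/-- The Walsh functions as elements of `L²`. -/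
def walshLp (n : ℕ) : Lp ℂ 2 μ := ContinuousMap.toLp 2 μ ℂ (walshContinuousMap n)

theorem coeFn_walshLp (n : ℕ) : walshLp μ n =ᵐ[μ] walsh n :=
  ContinuousMap.coeFn_toLp μ (walshContinuousMap n)

theorem topologicalClosure_span_walshLp :
    (Submodule.span ℂ (Set.range (walshLp μ))).topologicalClosure = ⊤ := by
  convert! (ContinuousMap.toLp_denseRange ℂ μ ℂ
    (p := 2) (by simp)).topologicalClosure_map_submodule topologicalClosure_span_walshContinuousMap
  rw [Submodule.map_span]
  unfold walshLp
  rw [Set.range_comp']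
  simp only [ContinuousLinearMap.coe_coe]

variable {μ}

theorem orthonormal_walshLp (hμ : IsUnifBernoulli μ) : Orthonormal ℂ (walshLp μ) := by
  rw [orthonormal_iff_ite]
  intro m n
  have h : ∀ ω, walshContinuousMap n ω * (starRingEnd ℂ) (walshContinuousMap m ω) =
      walsh (n ^^^ m) ω := fun ω => by
    rw [← walsh_mul_walsh, ← conj_walsh m]
    rfl
  rw [walshLp, walshLp, ContinuousMap.inner_toLp]
  simp_rw [h]
  split_ifs with hmn
  · simp [hmn, walsh_zero]
  · exact integral_walsh_of_ne_zero hμ fun h => hmn (Nat.xor_eq_zero_iff.1 h).symm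

theorem eq_of_forall_inner_walshLp_eq {f g : Lp ℂ 2 μ}
    (h : ∀ n, inner ℂ (walshLp μ n) f = inner ℂ (walshLp μ n) g) : f = g := by
  have hbot := Submodule.topologicalClosure_eq_top_iff.1 (topologicalClosure_span_walshLp μ)
  rw [← sub_eq_zero, ← Submodule.mem_bot ℂ, ← hbot, Submodule.mem_orthogonal]
  intro u hu
  induction hu using Submodule.span_induction with
  | mem x hx =>
    obtain ⟨n, rfl⟩ := hx
    rw [inner_sub_right, h, sub_self]
  | zero => simp
  | add x y _ _ hx hy => rw [inner_add_left, hx, hy, add_zero]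
  | smul a x _ hx => rw [inner_smul_left, hx, mul_zero]

theorem coeFn_smul_walshLp_zero (c : ℂ) : ⇑(c • walshLp μ 0) =ᵐ[μ] fun _ => c := by
  filter_upwards [Lp.coeFn_smul c (walshLp μ 0), coeFn_walshLp μ 0] with ω h₁ h₂
  rw [h₁, Pi.smul_apply, h₂, walsh_zero, smul_eq_mul, mul_one]

/-- The Koopman operator doubles the index of a Walsh function. -/
theorem koopman_walshLp (hS : MeasurePreserving shift μ μ) {U : Lp ℂ 2 μ →L[ℂ] Lp ℂ 2 μ}
    (hU : ∀ f : Lp ℂ 2 μ, ⇑(U f) =ᵐ[μ] fun ω => f (shift ω)) (n : ℕ) :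
    U (walshLp μ n) = walshLp μ (2 * n) := by
  refine Lp.ext ?_
  filter_upwards [hU (walshLp μ n), coeFn_walshLp μ (2 * n),
    hS.quasiMeasurePreserving.ae (coeFn_walshLp μ n)] with ω h₁ h₂ h₃
  rw [h₁, h₂, h₃, walsh_two_mul]

variable {V : Lp ℂ 2 μ →L[ℂ] Lp ℂ 2 μ}

/-- An eigenvector of the Perron–Frobenius operator whose eigenvalue satisfies `1 ≤ ‖z‖` is
constant. -/
theorem eq_smul_walshLp_zero_of_eigenvector (hμ : IsUnifBernoulli μ)
    (hV : ∀ n f, inner ℂ (walshLp μ n) (V f) = inner ℂ (walshLp μ (2 * n)) f)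
    {z : ℂ} (hz : 1 ≤ ‖z‖) {f : Lp ℂ 2 μ} (hf : V f = z • f) :
    f = inner ℂ (walshLp μ 0) f • walshLp μ 0 := by
  have ho := orthonormal_walshLp hμ
  have hstep : ∀ n, inner ℂ (walshLp μ (2 * n)) f = z * inner ℂ (walshLp μ n) f := fun n => by
    rw [← hV, hf, inner_smul_right]
  refine eq_of_forall_inner_walshLp_eq fun n => ?_
  rw [inner_smul_right, orthonormal_iff_ite.1 ho]
  rcases eq_or_ne n 0 with rfl | hn
  · simp
  rw [if_neg hn, mul_zero, ← norm_eq_zero]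
  have hpow : ∀ r, inner ℂ (walshLp μ (2 ^ r * n)) f = z ^ r * inner ℂ (walshLp μ n) f := fun r => by
    induction r with
    | zero => simp
    | succ r ih => rw [pow_succ', mul_assoc, hstep, ih, pow_succ', mul_assoc]
  have hinj : Function.Injective fun r : ℕ => 2 ^ r * n := fun a b hab =>
    Nat.pow_right_injective le_rfl (Nat.eq_of_mul_eq_mul_right (Nat.pos_of_ne_zero hn) hab)
  have hlim := ((ho.inner_products_summable f).comp_injective hinj).tendsto_atTop_zero
  have hle : ‖inner ℂ (walshLp μ n) f‖ ^ 2 ≤ 0 := ge_of_tendsto' hlim fun r => by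
    simp only [Function.comp_apply, hpow, norm_mul, norm_pow]
    gcongr
    exact le_mul_of_one_le_left (norm_nonneg _) (one_le_pow₀ hz)
  exact pow_eq_zero_iff two_ne_zero |>.1 (hle.antisymm (sq_nonneg _))

theorem summable_pow_mul_walsh {z : ℂ} (hz : ‖z‖ < 1) (m : ℕ) (ω : OneSided) :
    Summable fun r : ℕ => z ^ r * walsh (2 ^ r * m) ω :=
  .of_norm (by simpa [norm_walsh] using summable_geometric_of_lt_one (norm_nonneg z) hz)

theorem memLp_tsum_pow_mul_walsh {z : ℂ} (hz : ‖z‖ < 1) (m : ℕ) :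
    MemLp (fun ω => ∑' r : ℕ, z ^ r * walsh (2 ^ r * m) ω) 2 μ := by
  have hcont : Continuous fun ω => ∑' r : ℕ, z ^ r * walsh (2 ^ r * m) ω :=
    continuous_tsum (fun r => continuous_const.mul (continuous_walsh _))
      (summable_geometric_of_lt_one (norm_nonneg z) hz) fun r ω => by simp [norm_walsh]
  refine MemLp.of_bound hcont.aestronglyMeasurable (∑' r : ℕ, ‖z‖ ^ r) (ae_of_all _ fun ω => ?_)
  exact tsum_of_norm_bounded (summable_geometric_of_lt_one (norm_nonneg z) hz).hasSum
    fun r => by simp [norm_walsh]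

/-- The element `∑ r, z ^ r • W_{2 ^ r m}` of `L²`. -/
def walshSeries (μ : Measure OneSided) [IsProbabilityMeasure μ] {z : ℂ} (hz : ‖z‖ < 1) (m : ℕ) :
    Lp ℂ 2 μ :=
  (memLp_tsum_pow_mul_walsh (μ := μ) hz m).toLp

theorem coeFn_walshSeries {z : ℂ} (hz : ‖z‖ < 1) (m : ℕ) :
    walshSeries μ hz m =ᵐ[μ] fun ω => ∑' r : ℕ, z ^ r * walsh (2 ^ r * m) ω :=
  MemLp.coeFn_toLp _

theorem walshSeries_eq (hS : MeasurePreserving shift μ μ) {U : Lp ℂ 2 μ →L[ℂ] Lp ℂ 2 μ}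
    (hU : ∀ f : Lp ℂ 2 μ, ⇑(U f) =ᵐ[μ] fun ω => f (shift ω)) {z : ℂ} (hz : ‖z‖ < 1) (m : ℕ) :
    walshSeries μ hz m = walshLp μ m + z • U (walshSeries μ hz m) := by
  refine Lp.ext ?_
  filter_upwards [coeFn_walshSeries (μ := μ) hz m, coeFn_walshLp μ m, hU (walshSeries μ hz m),
    hS.quasiMeasurePreserving.ae (coeFn_walshSeries (μ := μ) hz m),
    Lp.coeFn_add (walshLp μ m) (z • U (walshSeries μ hz m)),
    Lp.coeFn_smul z (U (walshSeries μ hz m))] with ω h₁ h₂ h₃ h₄ h₅ h₆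
  rw [h₁, h₅, Pi.add_apply, h₂, h₆, Pi.smul_apply, h₃, h₄,
    (summable_pow_mul_walsh hz m ω).tsum_eq_zero_add, smul_eq_mul, ← tsum_mul_left]
  congr 1
  · simp
  · refine tsum_congr fun r => ?_
    rw [← walsh_two_mul, pow_succ', pow_succ', mul_assoc, mul_assoc]

end WalshLp

/-- The point spectrum of `V_S` on `L²(Σ₊, μ₊)` is `{|z| < 1} ∪ {1}`; the
eigenspace of `1` consists exactly of the constants (hence is one-dimensional); and for each
`|λ| < 1` and every odd `n` the function `∑_{r≥0} λ^r W_{2^r n}` is in `L²`, is an eigenfunction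
of `V_S` for the eigenvalue `λ`, and these eigenfunctions over distinct odd `n` are linearly
independent (so the eigenspace is infinite-dimensional). -/
theorem stmt_2
    (μ : Measure OneSided) [IsProbabilityMeasure μ]
    (hμ : IsUnifBernoulli μ)
    (hS : MeasurePreserving shift μ μ)
    (U V : Lp ℂ 2 μ →L[ℂ] Lp ℂ 2 μ)
    (hU : ∀ f : Lp ℂ 2 μ, ⇑(U f) =ᵐ[μ] fun ω => f (shift ω))
    (hV : V = ContinuousLinearMap.adjoint U) :
    (∀ z : ℂ, (∃ f : Lp ℂ 2 μ, f ≠ 0 ∧ V f = z • f) ↔ (‖z‖ < 1 ∨ z = 1)) ∧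
    (∀ f : Lp ℂ 2 μ, V f = (1 : ℂ) • f ↔ ∃ c : ℂ, ⇑f =ᵐ[μ] fun _ => c) ∧
    (∀ z : ℂ, ‖z‖ < 1 →
      ∃ F : {n : ℕ // Odd n} → Lp ℂ 2 μ,
        (∀ m : {n : ℕ // Odd n},
            ⇑(F m) =ᵐ[μ] fun ω => ∑' r : ℕ, z ^ r * walsh (2 ^ r * (m : ℕ)) ω) ∧
        (∀ m, F m ≠ 0 ∧ V (F m) = z • F m) ∧
        LinearIndependent ℂ F) := by
  have ho := orthonormal_walshLp hμ
  have hinner : ∀ n f, inner ℂ (walshLp μ n) (V f) = inner ℂ (walshLp μ (2 * n)) f := fun n f => by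
    rw [hV, ContinuousLinearMap.adjoint_inner_right, koopman_walshLp hS hU]
  have hVU : ∀ f, V (U f) = f := fun f => by
    have hnorm : ∀ g, ‖U g‖ = ‖g‖ := fun g => by
      rw [Lp.norm_def, Lp.norm_def, eLpNorm_congr_ae (hU g)]
      exact congr_arg ENNReal.toReal (eLpNorm_comp_measurePreserving (Lp.aestronglyMeasurable g) hS)
    rw [hV]
    exact DFunLike.congr_fun ((ContinuousLinearMap.norm_map_iff_adjoint_comp_self U).1 hnorm) f
  have hVodd : ∀ m, Odd m → V (walshLp μ m) = 0 := fun m hm => by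
    refine eq_of_forall_inner_walshLp_eq fun n => ?_
    rw [hinner, orthonormal_iff_ite.1 ho, inner_zero_right, if_neg]
    rintro rfl
    exact Nat.not_odd_iff_even.2 (even_two_mul n) hm
  have hconst : ∀ c : ℂ, V (c • walshLp μ 0) = c • walshLp μ 0 := fun c => by
    have h := koopman_walshLp hS hU 0
    rw [mul_zero] at h
    rw [map_smul]
    congr 1
    conv_lhs => rw [← h]
    exact hVU _
  have hker : ∀ z : ℂ, 1 ≤ ‖z‖ → ∀ f, V f = z • f → ∃ c : ℂ, f = c • walshLp μ 0 :=
    fun z hz f hf => ⟨_, eq_smul_walshLp_zero_of_eigenvector hμ hinner hz hf⟩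
  have heigen : ∀ {z : ℂ} (hz : ‖z‖ < 1) (m : ℕ), Odd m →
      V (walshSeries μ hz m) = z • walshSeries μ hz m := fun {z} hz m hm => by
    conv_lhs => rw [walshSeries_eq hS hU hz m]
    rw [map_add, map_smul, hVodd m hm, hVU, zero_add]
  have hdual : ∀ {z : ℂ} (hz : ‖z‖ < 1) (m n : ℕ), Odd n →
      inner ℂ (walshLp μ n) (walshSeries μ hz m) = if n = m then 1 else 0 := fun {z} hz m n hn => by
    rw [walshSeries_eq hS hU hz m, inner_add_right, inner_smul_right,
      ← ContinuousLinearMap.adjoint_inner_left, ← hV, hVodd n hn, inner_zero_left, mul_zero,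
      add_zero, orthonormal_iff_ite.1 ho]
  have hne : ∀ {z : ℂ} (hz : ‖z‖ < 1) (m : ℕ), Odd m → walshSeries μ hz m ≠ 0 :=
    fun {z} hz m hm h => by simpa [h] using hdual hz m m hm
  refine ⟨fun z => ⟨?_, ?_⟩, fun f => ⟨?_, ?_⟩, fun z hz => ⟨fun m => walshSeries μ hz m,
    fun m => coeFn_walshSeries hz m, fun m => ⟨hne hz m m.2, heigen hz m m.2⟩, ?_⟩⟩
  · rintro ⟨f, hf0, hf⟩
    refine or_iff_not_imp_left.2 fun hz => ?_
    obtain ⟨c, rfl⟩ := hker z (not_lt.1 hz) f hf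
    rw [hconst] at hf
    refine (smul_left_injective ℂ hf0 ?_).symm
    simpa using hf
  · rintro (hz | rfl)
    · exact ⟨_, hne hz 1 odd_one, heigen hz 1 odd_one⟩
    · exact ⟨walshLp μ 0, ho.ne_zero 0, by simpa using hconst 1⟩
  · intro hf
    obtain ⟨c, rfl⟩ := hker 1 (by simp) f hf
    exact ⟨c, coeFn_smul_walshLp_zero c⟩
  · rintro ⟨c, hc⟩
    rw [Lp.ext (hc.trans (coeFn_smul_walshLp_zero c).symm), hconst, one_smul]
  · refine linearIndependent_iff'.2 fun s g hg i hi => ?_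
    have h := congr_arg (inner ℂ (walshLp μ i)) hg
    simpa [inner_sum, inner_smul_right, hdual hz _ _ i.2, Subtype.coe_inj, hi] using h
end
end

section
/- For every polynomial f ∈ ℂ[h], the iterates of the Perron–Frobenius operator converge to the mean of f: V_S^k f → (∫_{Σ₊} f dμ₊) · 1 in L²(Σ₊, μ₊) as k → ∞. More precisely, if f = Σ_{i=0}^m c_i Φ_i then V_S^k f = Σ_{i=0}^m c_i 2^{-ik} Φ_i and c₀ = ∫_{Σ₊} f dμ₊. -/
open MeasureTheory Filter
open scoped ENNReal

noncomputable section

/-- `h(ω) = ∑_{i≥1} ω_i 2^{-i}`. -/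
def hFun (ω : OneSided) : ℝ := ∑' i : ℕ, (ω i : ℝ) / 2 ^ (i + 1)

section

variable {α : Type*} [MeasurableSpace α] {μ : Measure α}

/-- Pairing with an `L²` function that is almost everywhere `1` is integration. -/
lemma inner_eq_integral_of_ae_eq_one {e : Lp ℂ 2 μ} (he : ⇑e =ᵐ[μ] fun _ => 1)
    (g : Lp ℂ 2 μ) : inner ℂ e g = ∫ a, g a ∂μ := by
  rw [L2.inner_def]
  refine integral_congr_ae ?_
  filter_upwards [he] with a ha
  simp [ha]

/-- The adjoint of an operator fixing the constant function `1` preserves integrals. -/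
lemma integral_adjoint_apply {U : Lp ℂ 2 μ →L[ℂ] Lp ℂ 2 μ} {e : Lp ℂ 2 μ}
    (he : ⇑e =ᵐ[μ] fun _ => 1) (hU : U e = e) (g : Lp ℂ 2 μ) :
    ∫ a, (ContinuousLinearMap.adjoint U g : Lp ℂ 2 μ) a ∂μ = ∫ a, g a ∂μ := by
  rw [← inner_eq_integral_of_ae_eq_one he, ContinuousLinearMap.adjoint_inner_right, hU,
    inner_eq_integral_of_ae_eq_one he]

end

lemma pow_apply_of_apply_eq_smul {E : Type*} [NormedAddCommGroup E] [NormedSpace ℂ E]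
    {V : E →L[ℂ] E} {x : E} {a : ℂ} (h : V x = a • x) (k : ℕ) : (V ^ k) x = a ^ k • x := by
  induction k with
  | zero => simp
  | succ k ih => rw [pow_succ, mul_apply_eq_comp, h, map_smul, ih, smul_smul, pow_succ']

lemma tendsto_inv_two_pow_pow (i : ℕ) :
    Tendsto (fun k : ℕ => (((2 : ℂ) ^ i)⁻¹) ^ k) atTop (nhds (if i = 0 then 1 else 0)) := by
  split_ifs with hi
  · simp [hi]
  · refine tendsto_pow_atTop_nhds_zero_of_norm_lt_one ?_
    rw [norm_inv, norm_pow, Complex.norm_two]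
    exact inv_lt_one_of_one_lt₀ (one_lt_pow₀ one_lt_two hi)

/-- If `f = ∑_{i=0}^m c_i Φ_i ∈ ℂ[h]`, then `V_S^k f = ∑ c_i 2^{-ik} Φ_i`,
`c₀ = ∫ f dμ₊`, and `V_S^k f → (∫ f dμ₊) Φ₀` in `L²(Σ₊, μ₊)` as `k → ∞` (where `Φ₀ ≡ 1`). -/
theorem stmt_9
    (μ : Measure OneSided) [IsProbabilityMeasure μ]
    (hμ : IsUnifBernoulli μ)
    (hS : MeasurePreserving shift μ μ)
    (U V : Lp ℂ 2 μ →L[ℂ] Lp ℂ 2 μ)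
    (hU : ∀ f : Lp ℂ 2 μ, ⇑(U f) =ᵐ[μ] fun ω => f (shift ω))
    (hV : V = ContinuousLinearMap.adjoint U)
    (Φ : ℕ → Lp ℂ 2 μ)
    (hΦmonic : ∀ k : ℕ, ∃ p : Polynomial ℂ, p.Monic ∧ p.natDegree = k ∧
        ⇑(Φ k) =ᵐ[μ] fun ω => p.eval (hFun ω : ℂ))
    (hΦeig : ∀ k : ℕ, V (Φ k) = ((2 : ℂ) ^ k)⁻¹ • Φ k)
    (m : ℕ) (c : ℕ → ℂ) (f : Lp ℂ 2 μ)
    (hf : f = ∑ i ∈ Finset.range (m + 1), c i • Φ i) :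
    (∀ k : ℕ, (V ^ k) f = ∑ i ∈ Finset.range (m + 1), (c i * (((2 : ℂ) ^ i)⁻¹) ^ k) • Φ i) ∧
    c 0 = ∫ ω, f ω ∂μ ∧
    Tendsto (fun k : ℕ => (V ^ k) f) atTop (nhds ((∫ ω, f ω ∂μ) • Φ 0)) := by
  have hΦ0 : ⇑(Φ 0) =ᵐ[μ] fun _ => 1 := by
    obtain ⟨p, hp, hdeg, h⟩ := hΦmonic 0
    simpa [hp.natDegree_eq_zero.mp hdeg] using h
  have hU0 : U (Φ 0) = Φ 0 := by
    refine Lp.ext ((hU _).trans (EventuallyEq.trans ?_ hΦ0.symm))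
    exact hS.quasiMeasurePreserving.ae_eq_comp hΦ0
  have hone : ∫ ω, Φ 0 ω ∂μ = 1 := by
    rw [integral_congr_ae hΦ0]
    simp
  have hzero (i : ℕ) (hi : i ≠ 0) : inner ℂ (Φ 0) (Φ i) = 0 := by
    have h := integral_adjoint_apply hΦ0 hU0 (Φ i)
    rw [← hV, hΦeig, ← inner_eq_integral_of_ae_eq_one hΦ0,
      ← inner_eq_integral_of_ae_eq_one hΦ0, inner_smul_right] at h
    refine (mul_left_eq_self₀.mp h).resolve_left fun h1 => ?_
    have h2 := congrArg norm h1
    rw [norm_inv, norm_pow, Complex.norm_two, norm_one] at h2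
    exact (inv_lt_one_of_one_lt₀ (one_lt_pow₀ (one_lt_two (α := ℝ)) hi)).ne h2
  have hpow (k : ℕ) :
      (V ^ k) f = ∑ i ∈ Finset.range (m + 1), (c i * (((2 : ℂ) ^ i)⁻¹) ^ k) • Φ i := by
    simp only [hf, map_sum, map_smul, pow_apply_of_apply_eq_smul (hΦeig _), smul_smul]
  have hc : c 0 = ∫ ω, f ω ∂μ := by
    rw [← inner_eq_integral_of_ae_eq_one hΦ0, hf, inner_sum, Finset.sum_eq_single 0]
    · rw [inner_smul_right, inner_eq_integral_of_ae_eq_one hΦ0, hone, mul_one]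
    · intro i _ hi
      rw [inner_smul_right, hzero i hi, mul_zero]
    · simp
  refine ⟨hpow, hc, ?_⟩
  have hlim := tendsto_finsetSum (Finset.range (m + 1)) fun i _ =>
    ((tendsto_inv_two_pow_pow i).const_mul (c i)).smul_const (Φ i)
  simp_rw [hpow, ← hc]
  simpa using hlim
end
end

section
/- For the one-sided full β-shift with Bernoulli measure of weights p₀, …, p_{β−1}, the function h satisfies h(i*ω) = p₀ + ⋯ + p_{i−1} + p_i h(ω) for every i ∈ [β] and ω ∈ Σ₊. Consequently, V_S[h] = (Σ_{i∈[β]} p_i²) h + Σ_{0≤i<j≤β−1} p_i p_j, and for every n ≥ 0, V_S[hⁿ] = (Σ_{i∈[β]} p_i^{n+1}) hⁿ + q(h) where q(h) is a polynomial in h of degree strictly smaller than n. -/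
open MeasureTheory Filter
open scoped ENNReal

noncomputable section

/-- The left shift `(Sω)_j = ω_{j+1}` on `Σ₊ = [β]^ℕ` (index `n` corresponds to `ω_{n+1}`). -/
def shiftB {β : ℕ} (ω : ℕ → Fin β) : ℕ → Fin β := fun n => ω (n + 1)

/-- `i*ω = (i, ω₁, ω₂, …)`. -/
def consB {β : ℕ} (x : Fin β) (ω : ℕ → Fin β) : ℕ → Fin β := fun n =>
  match n with
  | 0 => x
  | Nat.succ k => ω k

/-- `μ` is the Bernoulli product measure with weights `p`. -/
def IsBernoulli {β : ℕ} (p : Fin β → ℝ) (μ : Measure (ℕ → Fin β)) : Prop :=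
  ∀ (n : ℕ) (x : Fin n → Fin β),
    μ {ω | ∀ i : Fin n, ω i = x i} = ∏ i : Fin n, ENNReal.ofReal (p (x i))

/-- `N_n^k(ω) = #{i ∈ {1,…,n−1} : ω_i = k}` (0-indexed: positions `0, …, n−2`). -/
def NCount {β : ℕ} (n : ℕ) (k : Fin β) (ω : ℕ → Fin β) : ℕ :=
  ((Finset.range n).filter fun i => ω i = k).card

/-- `h(ω) = ∑_{n≥1, ω_n ≠ 0} (p₀ + ⋯ + p_{ω_n − 1}) ∏_k p_k^{N_n^k(ω)}`; the `n`-th term of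
the paper corresponds to the `j = n − 1` summand below (note the factor `∑_{l < ω_n} p_l`
vanishes automatically when `ω_n = 0`). -/
def hB {β : ℕ} (p : Fin β → ℝ) (ω : ℕ → Fin β) : ℝ :=
  ∑' j : ℕ, (∑ l : Fin β, if (l : ℕ) < (ω j : ℕ) then p l else 0) *
    ∏ k : Fin β, p k ^ NCount j k ω

/-- The product of the weights of the first `j` letters. -/
theorem prod_pow_NCount {β : ℕ} (p : Fin β → ℝ) (ω : ℕ → Fin β) (j : ℕ) :
    ∏ k : Fin β, p k ^ NCount j k ω = ∏ i ∈ Finset.range j, p (ω i) := by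
  rw [← Finset.prod_fiberwise (Finset.range j) ω]
  refine Finset.prod_congr rfl fun k _ => ?_
  rw [NCount, ← Finset.prod_const]
  exact Finset.prod_congr rfl fun i hi => by rw [(Finset.mem_filter.1 hi).2]

theorem sum_lt_add_le_one {β : ℕ} {p : Fin β → ℝ} (hp : ∀ i, 0 < p i)
    (hpsum : ∑ i : Fin β, p i = 1) (i : Fin β) :
    (∑ l : Fin β, if (l : ℕ) < (i : ℕ) then p l else 0) + p i ≤ 1 := by
  have hi : p i = ∑ l : Fin β, if l = i then p l else 0 := by simp
  rw [hi, ← Finset.sum_add_distrib, ← hpsum]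
  refine Finset.sum_le_sum fun l _ => ?_
  by_cases h : l = i
  · simp [h]
  · have := (hp l).le
    split_ifs <;> simp [this]

theorem summable_hB {β : ℕ} {p : Fin β → ℝ} (hp : ∀ i, 0 < p i)
    (hpsum : ∑ i : Fin β, p i = 1) (ω : ℕ → Fin β) :
    Summable fun j : ℕ => (∑ l : Fin β, if (l : ℕ) < (ω j : ℕ) then p l else 0) *
      ∏ k : Fin β, p k ^ NCount j k ω := by
  simp only [prod_pow_NCount]
  have hpos : ∀ j, 0 < ∏ i ∈ Finset.range j, p (ω i) := fun j =>
    Finset.prod_pos fun i _ => hp _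
  refine summable_of_sum_range_le (c := 1) (fun j => mul_nonneg
    (Finset.sum_nonneg fun l _ => ?_) (hpos j).le) fun n => ?_
  · split_ifs
    exacts [(hp l).le, le_rfl]
  · suffices H : ∑ j ∈ Finset.range n,
        (∑ l : Fin β, if (l : ℕ) < (ω j : ℕ) then p l else 0) *
          ∏ i ∈ Finset.range j, p (ω i) ≤ 1 - ∏ i ∈ Finset.range n, p (ω i) by
      linarith [hpos n]
    induction n with
    | zero => simp
    | succ n ih =>
      rw [Finset.sum_range_succ, Finset.prod_range_succ]
      nlinarith [mul_le_mul_of_nonneg_right (sum_lt_add_le_one hp hpsum (ω n)) (hpos n).le]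

theorem hB_consB {β : ℕ} {p : Fin β → ℝ} (hp : ∀ i, 0 < p i)
    (hpsum : ∑ i : Fin β, p i = 1) (i : Fin β) (ω : ℕ → Fin β) :
    hB p (consB i ω) =
      (∑ l : Fin β, if (l : ℕ) < (i : ℕ) then p l else 0) + p i * hB p ω := by
  rw [hB, (summable_hB hp hpsum (consB i ω)).tsum_eq_zero_add, hB, ← tsum_mul_left]
  simp only [prod_pow_NCount, Finset.prod_range_succ', Finset.prod_range_zero, mul_one]
  congr 1
  refine tsum_congr fun j => ?_
  change (∑ l : Fin β, if (l : ℕ) < (ω j : ℕ) then p l else 0) *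
    ((∏ k ∈ Finset.range j, p (ω k)) * p i) = _
  ring

theorem measurable_consB {β : ℕ} (i : Fin β) : Measurable (consB i) := by
  refine measurable_pi_lambda _ fun n => ?_
  cases n with
  | zero => exact measurable_const
  | succ k => exact measurable_pi_apply k

/-- The cylinder sets of `Σ₊`, together with the empty set. -/
def cylinderSets (β : ℕ) : Set (Set (ℕ → Fin β)) :=
  {s | s = ∅ ∨ ∃ (n : ℕ) (x : Fin n → Fin β), s = {ω | ∀ i : Fin n, ω i = x i}}

theorem measurableSet_cylinder {β n : ℕ} (x : Fin n → Fin β) :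
    MeasurableSet {ω : ℕ → Fin β | ∀ i : Fin n, ω i = x i} := by
  rw [Set.ofPred_forall]
  exact MeasurableSet.iInter fun i =>
    measurableSet_eq_fun (measurable_pi_apply (i : ℕ)) measurable_const

theorem isPiSystem_cylinderSets (β : ℕ) : IsPiSystem (cylinderSets β) := by
  have key : ∀ {m n : ℕ} (x : Fin m → Fin β) (y : Fin n → Fin β), m ≤ n →
      ({ω : ℕ → Fin β | ∀ i : Fin m, ω i = x i} ∩
        {ω | ∀ i : Fin n, ω i = y i}).Nonempty →
      {ω : ℕ → Fin β | ∀ i : Fin m, ω i = x i} ∩ {ω | ∀ i : Fin n, ω i = y i} =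
        {ω | ∀ i : Fin n, ω i = y i} := by
    rintro m n x y hmn ⟨ω, hx, hy⟩
    refine Set.inter_eq_right.2 fun ω' hω' i => ?_
    have h1 := hω' ⟨i, i.2.trans_le hmn⟩
    have h2 := hy ⟨i, i.2.trans_le hmn⟩
    have h3 := hx i
    simp_all
  rintro s (rfl | ⟨m, x, rfl⟩) t (rfl | ⟨n, y, rfl⟩) hst
  · exact Or.inl (by simp)
  · exact Or.inl (by simp)
  · exact Or.inl (by simp)
  · rcases le_total m n with h | h
    · exact Or.inr ⟨n, y, key x y h hst⟩
    · rw [Set.inter_comm] at hst ⊢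
      exact Or.inr ⟨m, x, key y x h hst⟩

theorem generateFrom_cylinderSets (β : ℕ) :
    (inferInstance : MeasurableSpace (ℕ → Fin β)) =
      MeasurableSpace.generateFrom (cylinderSets β) := by
  apply le_antisymm
  · refine iSup_le fun j => ?_
    rintro _ ⟨A, -, rfl⟩
    have hA : (fun ω : ℕ → Fin β => ω j) ⁻¹' A =
        ⋃ x ∈ {x : Fin (j + 1) → Fin β | x (Fin.last j) ∈ A},
          {ω : ℕ → Fin β | ∀ i : Fin (j + 1), ω i = x i} := by
      ext ω
      simp only [Set.mem_preimage, Set.mem_iUnion, Set.mem_ofPred_eq, exists_prop]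
      constructor
      · exact fun h => ⟨fun i => ω i, by simpa using h, fun _ => rfl⟩
      · rintro ⟨x, hx, h⟩
        rw [← h] at hx
        simpa using hx
    rw [hA]
    exact MeasurableSet.biUnion (Set.to_countable _) fun x _ =>
      MeasurableSpace.measurableSet_generateFrom (Or.inr ⟨_, x, rfl⟩)
  · refine MeasurableSpace.generateFrom_le ?_
    rintro s (rfl | ⟨n, x, rfl⟩)
    · exact MeasurableSet.empty
    · exact measurableSet_cylinder x

/-- A Bernoulli measure is the mixture of its images under the inverse branches of the shift. -/
theorem IsBernoulli.eq_sum_map_consB {β : ℕ} {p : Fin β → ℝ} {μ : Measure (ℕ → Fin β)}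
    [IsProbabilityMeasure μ] (hμ : IsBernoulli p μ) (hp : ∀ i, 0 < p i)
    (hpsum : ∑ i : Fin β, p i = 1) :
    μ = ∑ i : Fin β, ENNReal.ofReal (p i) • μ.map (consB i) := by
  have hsum : ∑ i : Fin β, ENNReal.ofReal (p i) = 1 := by
    rw [← ENNReal.ofReal_sum_of_nonneg fun i _ => (hp i).le, hpsum, ENNReal.ofReal_one]
  have huniv : μ Set.univ =
      (∑ i : Fin β, ENNReal.ofReal (p i) • μ.map (consB i)) Set.univ := by
    simp [Measure.finsetSum_apply, Measure.map_apply (measurable_consB _), hsum]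
  refine ext_of_generate_finite (cylinderSets β) (generateFrom_cylinderSets β)
    (isPiSystem_cylinderSets β) ?_ huniv
  rintro s (rfl | ⟨n, x, rfl⟩)
  · simp
  cases n with
  | zero => simpa using huniv
  | succ n =>
    have hpre : ∀ i : Fin β, μ (consB i ⁻¹' {ω | ∀ k : Fin (n + 1), ω k = x k}) =
        if i = x 0 then ∏ k : Fin n, ENNReal.ofReal (p (x k.succ)) else 0 := by
      intro i
      split_ifs with h
      · rw [← hμ n fun k => x k.succ]
        congr 1
        ext ω
        simp [Fin.forall_fin_succ, consB, h]
      · convert measure_empty (μ := μ)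
        ext ω
        simp [Fin.forall_fin_succ, consB, h]
    simp only [Measure.finsetSum_apply, Measure.smul_apply, smul_eq_mul,
      Measure.map_apply (measurable_consB _) (measurableSet_cylinder x), hpre]
    rw [hμ, Fin.prod_univ_succ]
    simp

theorem memLp_map_consB {β : ℕ} {p : Fin β → ℝ} {μ : Measure (ℕ → Fin β)}
    (hdec : μ = ∑ i : Fin β, ENNReal.ofReal (p i) • μ.map (consB i)) (hp : ∀ i, 0 < p i)
    {q : ℝ≥0∞} {F : (ℕ → Fin β) → ℂ} (hF : MemLp F q μ) (i : Fin β) :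
    MemLp F q (μ.map (consB i)) := by
  have hle : ENNReal.ofReal (p i) • μ.map (consB i) ≤ μ := by
    conv_rhs => rw [hdec]
    exact Finset.single_le_sum (f := fun i => ENNReal.ofReal (p i) • μ.map (consB i))
      (fun _ _ => Measure.zero_le _) (Finset.mem_univ i)
  have h0 : ENNReal.ofReal (p i) ≠ 0 := by simpa using hp i
  have := (hF.mono_measure hle).smul_measure (c := (ENNReal.ofReal (p i))⁻¹) (by simpa using hp i)
  rwa [smul_smul, ENNReal.inv_mul_cancel h0 ENNReal.ofReal_ne_top, one_smul] at this

theorem integrable_map_consB {β : ℕ} {p : Fin β → ℝ} {μ : Measure (ℕ → Fin β)}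
    (hdec : μ = ∑ i : Fin β, ENNReal.ofReal (p i) • μ.map (consB i)) (hp : ∀ i, 0 < p i)
    {G : (ℕ → Fin β) → ℂ} (hG : Integrable G μ) (i : Fin β) :
    Integrable G (μ.map (consB i)) :=
  memLp_one_iff_integrable.1 (memLp_map_consB hdec hp (memLp_one_iff_integrable.2 hG) i)

theorem integral_eq_sum_consB {β : ℕ} {p : Fin β → ℝ} {μ : Measure (ℕ → Fin β)}
    (hdec : μ = ∑ i : Fin β, ENNReal.ofReal (p i) • μ.map (consB i)) (hp : ∀ i, 0 < p i)
    {G : (ℕ → Fin β) → ℂ} (hG : Integrable G μ) :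
    ∫ ω, G ω ∂μ = ∑ i : Fin β, (p i : ℂ) * ∫ ω, G (consB i ω) ∂μ := by
  have hi := integrable_map_consB hdec hp hG
  conv_lhs => rw [hdec]
  rw [integral_finsetSum_measure fun i _ => (hi i).smul_measure ENNReal.ofReal_ne_top]
  refine Finset.sum_congr rfl fun i _ => ?_
  rw [integral_smul_measure, integral_map (measurable_consB i).aemeasurable
    (hi i).aestronglyMeasurable, ENNReal.toReal_ofReal (hp i).le, Complex.real_smul]

/-- The Perron–Frobenius operator averages over the inverse branches of the shift. -/
theorem adjoint_koopman_ae_eq {β : ℕ} {p : Fin β → ℝ} {μ : Measure (ℕ → Fin β)}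
    (hdec : μ = ∑ i : Fin β, ENNReal.ofReal (p i) • μ.map (consB i)) (hp : ∀ i, 0 < p i)
    {U : Lp ℂ 2 μ →L[ℂ] Lp ℂ 2 μ}
    (hU : ∀ f : Lp ℂ 2 μ, ⇑(U f) =ᵐ[μ] fun ω => f (shiftB ω))
    {f : Lp ℂ 2 μ} {F : (ℕ → Fin β) → ℂ} (hf : ⇑f =ᵐ[μ] F) :
    ⇑(ContinuousLinearMap.adjoint U f) =ᵐ[μ]
      fun ω => ∑ i : Fin β, (p i : ℂ) * F (consB i ω) := by
  have hF : MemLp F 2 μ := (memLp_congr_ae hf).1 (Lp.memLp f)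
  have hFi : ∀ i, MemLp (fun ω => F (consB i ω)) 2 μ := fun i =>
    (memLp_map_consB hdec hp hF i).comp_of_map (measurable_consB i).aemeasurable
  have hW : MemLp (fun ω => ∑ i : Fin β, (p i : ℂ) * F (consB i ω)) 2 μ :=
    memLp_finsetSum _ fun i _ => (hFi i).const_mul _
  suffices h : ContinuousLinearMap.adjoint U f = hW.toLp _ by
    rw [h]
    exact hW.coeFn_toLp
  refine ext_inner_right ℂ fun g => ?_
  rw [ContinuousLinearMap.adjoint_inner_left, L2.inner_def, L2.inner_def]
  have hFg : (fun ω => inner ℂ (f ω) (U g ω)) =ᵐ[μ]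
      fun ω => inner ℂ (F ω) (g (shiftB ω)) := by
    filter_upwards [hf, hU g] with ω h1 h2
    rw [h1, h2]
  have hint : Integrable (fun ω => inner ℂ (F ω) (g (shiftB ω))) μ :=
    (L2.integrable_inner f (U g)).congr hFg
  have hWg : (fun ω => inner ℂ (hW.toLp _ ω) (g ω)) =ᵐ[μ]
      fun ω => ∑ i : Fin β, (p i : ℂ) * inner ℂ (F (consB i ω)) (g ω) := by
    filter_upwards [hW.coeFn_toLp] with ω h
    rw [h, sum_inner]
    refine Finset.sum_congr rfl fun i _ => ?_
    rw [← smul_eq_mul, inner_smul_left, Complex.conj_ofReal]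
  rw [integral_congr_ae hFg, integral_congr_ae hWg]
  have hcomp : ∀ i, Integrable (fun ω => inner ℂ (F (consB i ω)) (g ω)) μ := fun i =>
    (integrable_map_consB hdec hp hint i).comp_measurable (measurable_consB i)
  rw [integral_finsetSum _ fun i _ => (hcomp i).const_mul _, integral_eq_sum_consB hdec hp hint]
  exact Finset.sum_congr rfl fun i _ => (integral_const_mul _ _).symm

theorem exists_polynomial_affine_pow (a b : ℂ) (n : ℕ) :
    ∃ r : Polynomial ℂ, r.degree < (n : WithBot ℕ) ∧
      ∀ x : ℂ, (a + b * x) ^ n = b ^ n * x ^ n + r.eval x := by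
  refine ⟨∑ m ∈ Finset.range n,
    Polynomial.monomial m (b ^ m * a ^ (n - m) * (n.choose m : ℂ)), ?_, fun x => ?_⟩
  · rw [← Polynomial.mem_degreeLT]
    refine Submodule.sum_mem _ fun m hm => Polynomial.mem_degreeLT.2 ?_
    exact (Polynomial.degree_monomial_le _ _).trans_lt
      (by exact_mod_cast Finset.mem_range.1 hm)
  · rw [add_comm, add_pow, Finset.sum_range_succ, Polynomial.eval_finsetSum, add_comm]
    congr 1
    · simp [mul_pow]
    · refine Finset.sum_congr rfl fun m _ => ?_
      rw [Polynomial.eval_monomial, mul_pow]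
      ring

/-- `h(i*ω) = p₀ + ⋯ + p_{i−1} + p_i h(ω)`; consequently
`V_S[h] = (∑ p_i²) h + ∑_{i<j} p_i p_j` and `V_S[hⁿ] = (∑ p_i^{n+1}) hⁿ + q(h)` with
`deg q < n`. -/
theorem stmt_14
    (β : ℕ) (hβ : 2 ≤ β) (p : Fin β → ℝ)
    (hp : ∀ i, 0 < p i) (hpsum : ∑ i : Fin β, p i = 1)
    (μ : Measure (ℕ → Fin β)) [IsProbabilityMeasure μ]
    (hμ : IsBernoulli p μ)
    (hS : MeasurePreserving (shiftB (β := β)) μ μ)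
    (U V : Lp ℂ 2 μ →L[ℂ] Lp ℂ 2 μ)
    (hU : ∀ f : Lp ℂ 2 μ, ⇑(U f) =ᵐ[μ] fun ω => f (shiftB ω))
    (hV : V = ContinuousLinearMap.adjoint U) :
    (∀ (i : Fin β) (ω : ℕ → Fin β),
      hB p (consB i ω) = (∑ l : Fin β, if (l : ℕ) < (i : ℕ) then p l else 0) + p i * hB p ω) ∧
    (∀ f : Lp ℂ 2 μ, (⇑f =ᵐ[μ] fun ω => (hB p ω : ℂ)) →
      ⇑(V f) =ᵐ[μ] fun ω => (∑ i : Fin β, (p i : ℂ) ^ 2) * (hB p ω : ℂ) +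
        ∑ i : Fin β, ∑ j : Fin β, if i < j then (p i : ℂ) * (p j : ℂ) else 0) ∧
    (∀ n : ℕ, ∀ f : Lp ℂ 2 μ, (⇑f =ᵐ[μ] fun ω => (hB p ω : ℂ) ^ n) →
      ∃ q : Polynomial ℂ, q.degree < (n : WithBot ℕ) ∧
        ⇑(V f) =ᵐ[μ] fun ω =>
          (∑ i : Fin β, (p i : ℂ) ^ (n + 1)) * (hB p ω : ℂ) ^ n + q.eval (hB p ω : ℂ)) := by
  have hdec := hμ.eq_sum_map_consB hp hpsum
  have hcons := hB_consB hp hpsum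
  subst hV
  refine ⟨hcons, fun f hf => ?_, fun n f hf => ?_⟩
  · refine (adjoint_koopman_ae_eq hdec hp hU hf).trans (Eventually.of_forall fun ω => ?_)
    simp only [hcons]
    rw [Finset.sum_comm, Finset.sum_mul, ← Finset.sum_add_distrib]
    refine Finset.sum_congr rfl fun i _ => ?_
    push_cast
    rw [mul_add, Finset.mul_sum, add_comm]
    congr 1
    · ring
    · refine Finset.sum_congr rfl fun l _ => ?_
      simp only [Fin.lt_def]
      split_ifs
      · ring
      · simp
  · choose r hr hreval using fun i : Fin β => exists_polynomial_affine_pow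
      ((∑ l : Fin β, if (l : ℕ) < (i : ℕ) then p l else 0 : ℝ) : ℂ) (p i) n
    refine ⟨∑ i : Fin β, (p i : ℂ) • r i, ?_, ?_⟩
    · rw [← Polynomial.mem_degreeLT]
      exact Submodule.sum_mem _ fun i _ =>
        Submodule.smul_mem _ _ (Polynomial.mem_degreeLT.2 (hr i))
    · refine (adjoint_koopman_ae_eq hdec hp hU hf).trans (Eventually.of_forall fun ω => ?_)
      simp only [hcons, Complex.ofReal_add, Complex.ofReal_mul, hreval,
        Polynomial.eval_finsetSum, Polynomial.eval_smul, smul_eq_mul]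
      rw [Finset.sum_mul, ← Finset.sum_add_distrib]
      refine Finset.sum_congr rfl fun i _ => ?_
      ring
end
end

section
/- For the golden-ratio subshift with its stationary Markov measure, the pushforward measure h_*μ₊ on [0,1] is absolutely continuous with density ρ(x) = φ³/(1+φ²) for 0 ≤ x ≤ 1/φ and ρ(x) = φ²/(1+φ²) for 1/φ < x ≤ 1. -/
open MeasureTheory Filter
open scoped ENNReal

noncomputable section

/-- The golden ratio `φ = (1 + √5)/2`. -/
def goldphi : ℝ := (1 + Real.sqrt 5) / 2

/-- The stationary probability vector `π = (φ², 1)/(φ² + 1)`. -/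
def gpi (i : Fin 2) : ℝ :=
  if i = 0 then goldphi ^ 2 / (goldphi ^ 2 + 1) else 1 / (goldphi ^ 2 + 1)

/-- The transition matrix `P = [[φ⁻¹, φ⁻²], [1, 0]]`. -/
def gP (i j : Fin 2) : ℝ :=
  if i = 0 then (if j = 0 then goldphi⁻¹ else goldphi⁻¹ ^ 2)
  else (if j = 0 then 1 else 0)

/-- `μ` is the Markov measure on cylinders: `μ(C[i₁,…,i_r]) = π_{i₁} p_{i₁i₂} ⋯ p_{i_{r−1}i_r}`.
(Since `p₁₁ = 0`, `μ` is carried by the subshift `Σ₊^A` with no two consecutive `1`s; we model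
`L²(Σ₊^A, μ₊)` as `L²` of the full space `{0,1}^ℕ` with respect to this measure.) -/
def IsGoldenMarkov (μ : Measure (ℕ → Fin 2)) : Prop :=
  ∀ (r : ℕ) (x : ℕ → Fin 2),
    μ {ω | ∀ k ≤ r, ω k = x k} =
      ENNReal.ofReal (gpi (x 0) * ∏ k ∈ Finset.range r, gP (x k) (x (k + 1)))

/-- `h(ω) = ∑_{k≥1} ω_k φ^{-k}`. -/
def hGold (ω : ℕ → Fin 2) : ℝ := ∑' k : ℕ, (ω k : ℝ) * goldphi⁻¹ ^ (k + 1)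

lemma goldphi_sq : goldphi ^ 2 = goldphi + 1 := Real.goldenRatio_sq

lemma one_lt_goldphi : 1 < goldphi := Real.one_lt_goldenRatio

lemma goldphi_pos : 0 < goldphi := zero_lt_one.trans one_lt_goldphi

lemma goldphi_inv : goldphi⁻¹ = goldphi - 1 := by
  have h := goldphi_sq
  have hpos := goldphi_pos
  field_simp
  linarith

lemma goldphi_mul_lt_one_iff (t : ℝ) : goldphi * t < 1 ↔ t < goldphi⁻¹ := by
  rw [← one_div, lt_div_iff₀' goldphi_pos]

/-- The first digit of the greedy expansion of `t` in base `φ`. -/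
def betaDigit (t : ℝ) : Fin 2 := if t < goldphi⁻¹ then 0 else 1

/-- The `β`-transformation `t ↦ φ t - ⌊φ t⌋` of `[0, 1)`, for `β = φ`. -/
def betaMap (t : ℝ) : ℝ := goldphi * t - (betaDigit t : ℝ)

/-- The greedy expansion of `t` in base `φ`. -/
def betaExpansion (t : ℝ) (k : ℕ) : Fin 2 := betaDigit (betaMap^[k] t)

lemma betaExpansion_succ (t : ℝ) (k : ℕ) :
    betaExpansion t (k + 1) = betaExpansion (betaMap t) k := rfl

lemma measurable_betaDigit : Measurable betaDigit :=
  Measurable.ite measurableSet_Iio measurable_const measurable_const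

lemma measurable_betaMap : Measurable betaMap :=
  (measurable_const.mul measurable_id).sub
    ((measurable_of_countable fun i : Fin 2 => (i : ℝ)).comp measurable_betaDigit)

lemma measurable_betaExpansion : Measurable betaExpansion :=
  measurable_pi_lambda _ fun k => measurable_betaDigit.comp (measurable_betaMap.iterate k)

lemma betaMap_mem_Ico {t : ℝ} (ht : t ∈ Set.Ico (0 : ℝ) 1) : betaMap t ∈ Set.Ico (0 : ℝ) 1 := by
  have hpos := goldphi_pos
  have hlt := goldphi_mul_lt_one_iff t
  have hinv := goldphi_inv
  have h2 : goldphi < 2 := Real.goldenRatio_lt_two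
  obtain ⟨h0, h1⟩ := ht
  unfold betaMap betaDigit
  split_ifs with h
  · have := hlt.2 h
    have := mul_nonneg hpos.le h0
    simp only [Fin.val_zero, Nat.cast_zero, sub_zero, Set.mem_Ico]
    constructor <;> linarith
  · have := mt hlt.1 h
    simp only [Fin.val_one, Nat.cast_one, Set.mem_Ico]
    constructor <;> nlinarith

lemma betaMap_iterate_mem_Ico {t : ℝ} (ht : t ∈ Set.Ico (0 : ℝ) 1) (n : ℕ) :
    betaMap^[n] t ∈ Set.Ico (0 : ℝ) 1 := by
  induction n with
  | zero => exact ht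
  | succ n ih => rw [Function.iterate_succ_apply']; exact betaMap_mem_Ico ih

lemma sum_betaExpansion (t : ℝ) (n : ℕ) :
    ∑ k ∈ Finset.range n, (betaExpansion t k : ℝ) * goldphi⁻¹ ^ (k + 1) =
      t - goldphi⁻¹ ^ n * betaMap^[n] t := by
  induction n with
  | zero => simp
  | succ n ih =>
    have hne := goldphi_pos.ne'
    rw [Finset.sum_range_succ, ih, Function.iterate_succ_apply', betaExpansion, betaMap, pow_succ]
    field_simp
    ring

lemma goldphi_inv_lt_one : goldphi⁻¹ < 1 := inv_lt_one_of_one_lt₀ one_lt_goldphi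

lemma goldphi_inv_pos : 0 < goldphi⁻¹ := inv_pos.2 goldphi_pos

lemma hGold_betaExpansion {t : ℝ} (ht : t ∈ Set.Ico (0 : ℝ) 1) : hGold (betaExpansion t) = t := by
  have hinv := goldphi_inv_pos
  refine HasSum.tsum_eq ((hasSum_iff_tendsto_nat_of_nonneg (fun k => by positivity) t).2 ?_)
  simp_rw [sum_betaExpansion]
  have hzero : Tendsto (fun n => goldphi⁻¹ ^ n * betaMap^[n] t) atTop (nhds 0) := by
    refine squeeze_zero (fun n => mul_nonneg (pow_nonneg hinv.le n) (betaMap_iterate_mem_Ico ht n).1)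
      (fun n => mul_le_of_le_one_right (pow_nonneg hinv.le n) (betaMap_iterate_mem_Ico ht n).2.le)
      (tendsto_pow_atTop_nhds_zero_of_lt_one hinv.le goldphi_inv_lt_one)
  simpa using tendsto_const_nhds.sub hzero

lemma continuous_hGold : Continuous hGold := by
  have hinv := goldphi_inv_pos
  refine continuous_tsum (u := fun k => goldphi⁻¹ ^ (k + 1)) (fun k => ?_) ?_ fun k ω => ?_
  · exact ((continuous_of_discreteTopology (f := fun i : Fin 2 => (i : ℝ))).comp
      (continuous_apply k)).mul continuous_const
  · exact (summable_nat_add_iff 1).2 (summable_geometric_of_lt_one hinv.le goldphi_inv_lt_one)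
  · rw [Real.norm_of_nonneg (by positivity)]
    refine mul_le_of_le_one_left (by positivity) ?_
    exact_mod_cast Nat.lt_succ_iff.1 (ω k).isLt

/-- The points of `[0, 1)` whose expansion in base `φ` agrees with `x` up to index `r`. -/
def betaCylinder (r : ℕ) (x : ℕ → Fin 2) : Set ℝ :=
  {t | t ∈ Set.Ico (0 : ℝ) 1 ∧ ∀ k ≤ r, betaExpansion t k = x k}

lemma betaCylinder_succ (r : ℕ) (x : ℕ → Fin 2) :
    betaCylinder (r + 1) x =
      {t | t ∈ Set.Ico (0 : ℝ) 1 ∧ betaDigit t = x 0 ∧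
        betaMap t ∈ betaCylinder r fun k => x (k + 1)} := by
  ext t
  constructor
  · rintro ⟨ht, h⟩
    exact ⟨ht, h 0 (by omega), betaMap_mem_Ico ht, fun k hk => h (k + 1) (by omega)⟩
  · rintro ⟨ht, h0, -, h⟩
    refine ⟨ht, fun k hk => ?_⟩
    cases k with
    | zero => exact h0
    | succ k => exact h k (by omega)

lemma betaDigit_eq_zero_iff {t : ℝ} : betaDigit t = 0 ↔ t < goldphi⁻¹ := by
  simp [betaDigit]

lemma betaDigit_eq_one_iff {t : ℝ} : betaDigit t = 1 ↔ goldphi⁻¹ ≤ t := by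
  simp [betaDigit]

lemma betaCylinder_succ_eq_empty (r : ℕ) (x : ℕ → Fin 2) (h0 : x 0 = 1) (h1 : x 1 = 1) :
    betaCylinder (r + 1) x = ∅ := by
  rw [betaCylinder_succ, Set.eq_empty_iff_forall_notMem]
  rintro t ⟨ht, hd, -, h⟩
  have hdig : betaDigit (betaMap t) = 1 := (h 0 (Nat.zero_le _)).trans h1
  rw [betaDigit_eq_one_iff, betaMap, hd, h0, goldphi_inv] at hdig
  simp only [Fin.val_one, Nat.cast_one] at hdig
  nlinarith [ht.2, goldphi_pos]

lemma betaCylinder_succ_eq_preimage (r : ℕ) (x : ℕ → Fin 2) (hx : x 0 = 0 ∨ x 1 = 0) :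
    betaCylinder (r + 1) x =
      (fun t => goldphi * t) ⁻¹' ((fun t => -(x 0 : ℝ) + t) ⁻¹'
        betaCylinder r fun k => x (k + 1)) := by
  have hpos := goldphi_pos
  rw [betaCylinder_succ]
  ext t
  simp only [Set.mem_ofPred_eq, Set.mem_preimage]
  constructor
  · rintro ⟨-, hd, h⟩
    rwa [betaMap, hd, sub_eq_neg_add] at h
  · intro h
    have hlt := goldphi_mul_lt_one_iff t
    have hinv := goldphi_inv_lt_one
    have hinv' := goldphi_inv
    obtain ⟨⟨hl, hu⟩, hd⟩ := id h
    have hmain : t ∈ Set.Ico (0 : ℝ) 1 ∧ betaDigit t = x 0 := by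
      rcases Fin.exists_fin_two.1 ⟨x 0, rfl⟩ with h0 | h0
      · simp only [h0, Fin.val_zero, Nat.cast_zero, neg_zero, zero_add] at hl hu ⊢
        have h1 := hlt.1 hu
        exact ⟨⟨nonneg_of_mul_nonneg_right hl hpos, h1.trans hinv⟩, betaDigit_eq_zero_iff.2 h1⟩
      · have hx1 : x 1 = 0 := hx.resolve_left (by rw [h0]; exact one_ne_zero)
        have hdig := (hd 0 (Nat.zero_le _)).trans hx1
        replace hdig := betaDigit_eq_zero_iff.1 hdig
        simp only [h0, Fin.val_one, Nat.cast_one, Function.iterate_zero, id] at hl hdig ⊢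
        have h1 : goldphi⁻¹ ≤ t := not_lt.1 fun hh => by linarith [hlt.2 hh]
        exact ⟨⟨goldphi_inv_pos.le.trans h1, by nlinarith⟩, betaDigit_eq_one_iff.2 h1⟩
    refine ⟨hmain.1, hmain.2, ?_⟩
    rwa [betaMap, hmain.2, sub_eq_neg_add]

lemma gP_nonneg (i j : Fin 2) : 0 ≤ gP i j := by
  have := goldphi_inv_pos
  unfold gP
  split_ifs <;> positivity

lemma volume_betaCylinder (r : ℕ) (x : ℕ → Fin 2) :
    volume (betaCylinder r x) =
      ENNReal.ofReal (goldphi⁻¹ ^ ((x 0 : ℕ) + 1) *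
        ∏ k ∈ Finset.range r, gP (x k) (x (k + 1))) := by
  have hinv := goldphi_inv_pos
  have hinv1 := goldphi_inv_lt_one
  induction r generalizing x with
  | zero =>
    rcases Fin.exists_fin_two.1 ⟨x 0, rfl⟩ with h0 | h0
    · have : betaCylinder 0 x = Set.Ico 0 goldphi⁻¹ := by
        ext t
        simp only [betaCylinder, Nat.le_zero, forall_eq, betaExpansion, Function.iterate_zero, id,
          h0, betaDigit_eq_zero_iff, Set.mem_ofPred_eq, Set.mem_Ico]
        constructor
        · rintro ⟨⟨h1, h2⟩, h3⟩; exact ⟨h1, h3⟩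
        · rintro ⟨h1, h2⟩; exact ⟨⟨h1, h2.trans hinv1⟩, h2⟩
      rw [this, Real.volume_Ico, h0]
      simp
    · have : betaCylinder 0 x = Set.Ico goldphi⁻¹ 1 := by
        ext t
        simp only [betaCylinder, Nat.le_zero, forall_eq, betaExpansion, Function.iterate_zero, id,
          h0, betaDigit_eq_one_iff, Set.mem_ofPred_eq, Set.mem_Ico]
        constructor
        · rintro ⟨⟨h1, h2⟩, h3⟩; exact ⟨h3, h2⟩
        · rintro ⟨h1, h2⟩; exact ⟨⟨hinv.le.trans h1, h2⟩, h1⟩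
      rw [this, Real.volume_Ico, h0]
      simp only [Fin.val_one, Finset.range_zero, Finset.prod_empty, mul_one]
      congr 1
      rw [goldphi_inv]
      linear_combination -goldphi_sq
  | succ r ih =>
    by_cases hx : x 0 = 0 ∨ x 1 = 0
    · rw [betaCylinder_succ_eq_preimage r x hx, Real.volume_preimage_mul_left goldphi_pos.ne',
        measure_preimage_add, ih, abs_of_pos hinv, ← ENNReal.ofReal_mul hinv.le,
        Finset.prod_range_succ' _ r]
      congr 1
      have key : goldphi⁻¹ * goldphi⁻¹ ^ ((x 1 : ℕ) + 1) =
          goldphi⁻¹ ^ ((x 0 : ℕ) + 1) * gP (x 0) (x 1) := by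
        generalize x 0 = i at hx
        generalize x 1 = j at hx
        fin_cases i <;> fin_cases j <;> (simp [gP] at hx ⊢; try ring)
      simp only [zero_add]
      rw [← mul_assoc, key]
      ring
    · push Not at hx
      have h0 : x 0 = 1 := by omega
      have h1 : x 1 = 1 := by omega
      rw [betaCylinder_succ_eq_empty r x h0 h1, Finset.prod_range_succ' _ r]
      simp [gP, h0, h1]

/-- The density of the invariant measure of the `β`-transformation, for `β = φ`. -/
def betaDensity (t : ℝ) : ℝ≥0∞ :=
  ENNReal.ofReal (if t ≤ goldphi⁻¹ then goldphi ^ 3 / (1 + goldphi ^ 2)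
    else goldphi ^ 2 / (1 + goldphi ^ 2))

lemma betaDensity_ae_eq :
    betaDensity =ᵐ[volume] fun t => ENNReal.ofReal (gpi (betaDigit t) *
      goldphi ^ ((betaDigit t : ℕ) + 1)) := by
  filter_upwards [compl_mem_ae_iff.2 (measure_singleton goldphi⁻¹)] with t ht
  have hpos := goldphi_pos
  unfold betaDensity
  congr 1
  rcases lt_or_gt_of_ne ht with h | h
  · rw [if_pos h.le, betaDigit_eq_zero_iff.2 h]
    simp only [gpi, if_true, Fin.val_zero]
    field_simp
    ring
  · rw [if_neg h.not_ge, betaDigit_eq_one_iff.2 h.le]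
    simp [gpi]
    field_simp
    ring

lemma measurableSet_forall_le_eq (r : ℕ) (x : ℕ → Fin 2) :
    MeasurableSet {ω : ℕ → Fin 2 | ∀ k ≤ r, ω k = x k} := by
  simp only [Set.ofPred_forall]
  exact MeasurableSet.iInter fun k => MeasurableSet.iInter fun _ =>
    measurableSet_eq_fun (measurable_pi_apply k) measurable_const

lemma measurableSet_betaCylinder (r : ℕ) (x : ℕ → Fin 2) :
    MeasurableSet (betaCylinder r x) := by
  exact measurableSet_Ico.inter (measurable_betaExpansion (measurableSet_forall_le_eq r x))

lemma gpi_nonneg (i : Fin 2) : 0 ≤ gpi i := by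
  unfold gpi
  split_ifs <;> positivity

lemma isGoldenMarkov_map_betaExpansion :
    IsGoldenMarkov
      (Measure.map betaExpansion ((volume.restrict (Set.Ico 0 1)).withDensity betaDensity)) := by
  intro r x
  have hpos := goldphi_pos
  have hset := measurableSet_forall_le_eq r x
  have hpre := measurable_betaExpansion hset
  rw [Measure.map_apply measurable_betaExpansion hset, withDensity_apply _ hpre,
    Measure.restrict_restrict hpre, Set.inter_comm]
  change ∫⁻ t in betaCylinder r x, betaDensity t = _
  have hconst : ∀ᵐ t ∂volume, t ∈ betaCylinder r x → betaDensity t =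
      ENNReal.ofReal (gpi (x 0) * goldphi ^ ((x 0 : ℕ) + 1)) := by
    filter_upwards [betaDensity_ae_eq] with t ht hmem
    have h0 : betaDigit t = x 0 := hmem.2 0 (Nat.zero_le _)
    rw [ht, h0]
  rw [setLIntegral_congr_fun_ae (measurableSet_betaCylinder r x) hconst, setLIntegral_const,
    volume_betaCylinder, ← ENNReal.ofReal_mul (mul_nonneg (gpi_nonneg _) (by positivity))]
  congr 1
  rw [inv_pow]
  field_simp

lemma IsGoldenMarkov.eq {μ ν : Measure (ℕ → Fin 2)} [IsFiniteMeasure μ]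
    (hμ : IsGoldenMarkov μ) (hν : IsGoldenMarkov ν) : μ = ν := by
  have huniv : μ Set.univ = ν Set.univ := by
    have hunion : (Set.univ : Set (ℕ → Fin 2)) =
        {ω | ∀ k ≤ 0, ω k = (0 : Fin 2)} ∪ {ω | ∀ k ≤ 0, ω k = (1 : Fin 2)} := by
      ext ω
      simp only [Set.mem_univ, Nat.le_zero, forall_eq, Set.mem_union, Set.mem_ofPred_eq, true_iff]
      omega
    have hdisj : Disjoint {ω : ℕ → Fin 2 | ∀ k ≤ 0, ω k = (0 : Fin 2)}
        {ω | ∀ k ≤ 0, ω k = (1 : Fin 2)} :=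
      Set.disjoint_left.2 fun ω h h' => by simpa using (h 0 le_rfl).symm.trans (h' 0 le_rfl)
    have hmeas := measurableSet_forall_le_eq 0 fun _ => 1
    rw [hunion, measure_union hdisj hmeas, measure_union hdisj hmeas,
      hμ 0 fun _ => 0, hμ 0 fun _ => 1, hν 0 fun _ => 0, hν 0 fun _ => 1]
  refine ext_of_generate_finite _
    ((BorelSpace.measurable_eq (α := ℕ → Fin 2)).trans
      (PiNat.isTopologicalBasis_cylinders fun _ => Fin 2).borel_eq_generateFrom) ?_ ?_ huniv
  · rintro _ ⟨x, m, rfl⟩ _ ⟨y, n, rfl⟩ ⟨z, hzx, hzy⟩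
    rw [← PiNat.mem_cylinder_iff_eq.1 hzx, ← PiNat.mem_cylinder_iff_eq.1 hzy]
    rcases le_total m n with h | h
    · exact ⟨z, n, Set.inter_eq_right.2 (PiNat.cylinder_anti z h)⟩
    · exact ⟨z, m, Set.inter_eq_left.2 (PiNat.cylinder_anti z h)⟩
  · rintro _ ⟨x, n, rfl⟩
    cases n with
    | zero => simpa using huniv
    | succ n =>
      have hcyl : PiNat.cylinder x (n + 1) = {ω | ∀ k ≤ n, ω k = x k} := by
        ext ω
        simp [PiNat.cylinder]
      rw [hcyl, hμ, hν]

/-- The pushforward `h_*μ₊` is absolutely continuous on `[0,1]` with density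
`ρ(x) = φ³/(1+φ²)` for `0 ≤ x ≤ 1/φ` and `ρ(x) = φ²/(1+φ²)` for `1/φ < x ≤ 1`. -/
theorem stmt_16
    (μ : Measure (ℕ → Fin 2)) [IsProbabilityMeasure μ]
    (hμ : IsGoldenMarkov μ) :
    Measure.map hGold μ =
      (volume.restrict (Set.Icc (0 : ℝ) 1)).withDensity fun x =>
        ENNReal.ofReal
          (if x ≤ goldphi⁻¹ then goldphi ^ 3 / (1 + goldphi ^ 2)
           else goldphi ^ 2 / (1 + goldphi ^ 2)) := by
  change Measure.map hGold μ = (volume.restrict (Set.Icc (0 : ℝ) 1)).withDensity betaDensity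
  rw [hμ.eq isGoldenMarkov_map_betaExpansion,
    Measure.map_map continuous_hGold.measurable measurable_betaExpansion,
    ← Measure.restrict_congr_set (Ico_ae_eq_Icc (μ := volume) (a := (0 : ℝ)) (b := 1))]
  have hid : hGold ∘ betaExpansion =ᵐ[(volume.restrict (Set.Ico 0 1)).withDensity betaDensity]
      id :=
    (withDensity_absolutelyContinuous _ _).ae_le <|
      (ae_restrict_mem measurableSet_Ico).mono fun t ht => hGold_betaExpansion ht
  rw [Measure.map_congr hid, Measure.map_id]
end
end
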